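/- There exists a constant $c > 0$ such that for all $f, g \in \dot H^1(\mathbb{R}^3)$, the product $fg$ lies in $\dot H^{1/2}(\mathbb{R}^3)$ and $\|fg\|_{\dot H^{1/2}(\mathbb{R}^3)} \le c \, \|f\|_{\dot H^1(\mathbb{R}^3)} \, \|g\|_{\dot H^1(\mathbb{R}^3)}$. -/

import Mathlib

open MeasureTheory FourierTransform
abbrev E3 := EuclideanSpace ℝ (Fin 3)

theorem A1 (f : E3 → ℂ) (hf : Integrable f) : Continuous (𝓕 f) :=
  VectorFourier.fourierIntegral_continuous Real.continuous_fourierChar continuous_inner hf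

theorem A2 (f : E3 → ℂ) (hf : Integrable f) (hF : MemLp (𝓕 f) 2 volume) :
    ∃ h : Lp (α := E3) ℂ 2 volume, h =ᵐ[volume] f ∧ (𝓕 h : Lp (α := E3) ℂ 2 volume) =ᵐ[volume] 𝓕 f := by
  refine ⟨𝓕⁻ (hF.toLp (𝓕 f)), ?_, ?_⟩
  swap
  · rw [FourierTransform.fourier_fourierInv_eq]
    exact hF.coeFn_toLp
  set h : Lp (α := E3) ℂ 2 volume := 𝓕⁻ (hF.toLp (𝓕 f)) with hh
  have hFh : (𝓕 h : Lp (α := E3) ℂ 2 volume) = hF.toLp (𝓕 f) := by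
    rw [hh, FourierTransform.fourier_fourierInv_eq]
  have key : ∀ φ : SchwartzMap E3 ℂ, ∫ x, (𝓕 φ) x • h x = ∫ x, (𝓕 φ) x • f x := by
    intro φ
    have h1 := congrArg (fun T : TemperedDistribution E3 ℂ => T φ)
      (Lp.fourier_toTemperedDistribution_eq h)
    simp only [TemperedDistribution.fourier_apply] at h1
    rw [Lp.toTemperedDistribution_apply (μ := (volume : Measure E3)),
      Lp.toTemperedDistribution_apply (μ := (volume : Measure E3)), hFh] at h1
    rw [h1]
    have h2 : ∫ x, φ x • (hF.toLp (𝓕 f)) x = ∫ x, φ x • 𝓕 f x := by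
      apply integral_congr_ae
      filter_upwards [hF.coeFn_toLp] with x hx
      rw [hx]
    rw [h2]
    have h3 := VectorFourier.integral_fourierIntegral_smul_eq_flip (L := innerₗ E3) (f := φ) (g := f)
      Real.continuous_fourierChar continuous_inner (φ.integrable (μ := volume)) hf
    rw [flip_innerₗ] at h3
    rw [SchwartzMap.fourier_coe]
    exact h3.symm
  have hloc : LocallyIntegrable h volume :=
    (Lp.memLp h).locallyIntegrable (by norm_num)
  apply ae_eq_of_integral_contDiff_smul_eq hloc hf.locallyIntegrable
  intro g hg hgc
  have hgc' : HasCompactSupport (fun x => (g x : ℂ)) := hgc.comp_left (g := fun t : ℝ => (t:ℂ)) (by simp)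
  have hg' : ContDiff ℝ (⊤ : ℕ∞) (fun x => (g x : ℂ)) := Complex.ofRealCLM.contDiff.comp hg
  have := key (𝓕⁻ (hgc'.toSchwartzMap hg'))
  rw [FourierTransform.fourier_fourierInv_eq] at this
  simpa using this

theorem A3 (f : E3 → ℂ) (hf : Integrable f)
    (h : Integrable (fun ξ : E3 => ‖ξ‖ ^ 2 * ‖𝓕 f ξ‖ ^ 2)) : MemLp (𝓕 f) 2 volume := by
  have hc := A1 f hf
  rw [memLp_two_iff_integrable_sq_norm hc.aestronglyMeasurable]
  have h1 : IntegrableOn (fun ξ : E3 => ‖𝓕 f ξ‖ ^ 2) (Metric.closedBall 0 1) :=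
    (by fun_prop : Continuous (fun ξ : E3 => ‖𝓕 f ξ‖ ^ 2)).continuousOn.integrableOn_compact
      (isCompact_closedBall _ _)
  have h2 := (integrable_indicator_iff measurableSet_closedBall).2 h1
  refine (h2.add h).mono' (by fun_prop) (Filter.Eventually.of_forall fun ξ => ?_)
  simp only [Pi.add_apply, Set.indicator, norm_pow, norm_norm, Metric.mem_closedBall, dist_zero_right]
  split_ifs with hx
  · have : 0 ≤ ‖ξ‖ ^ 2 * ‖𝓕 f ξ‖ ^ 2 := by positivity
    linarith
  · have : 1 ≤ ‖ξ‖ ^ 2 := by nlinarith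
    nlinarith [sq_nonneg ‖𝓕 f ξ‖]

theorem A4 (f g : E3 → ℂ) (hf : Integrable f) (hg : Integrable g) (hF : MemLp (𝓕 f) 2 volume)
    (hG : MemLp (𝓕 g) 2 volume) (ξ : E3) :
    𝓕 (f * g) ξ = ∫ η, 𝓕 f (ξ - η) * 𝓕 g η := by
  set f1 : E3 → ℂ := fun x => (starRingEnd ℂ) (Real.fourierChar (-inner ℝ x ξ) • f x) with hf1
  have hF1 : ∀ η, 𝓕 f1 η = (starRingEnd ℂ) (𝓕 f (ξ - η)) := by
    intro η
    rw [Real.fourier_eq, Real.fourier_eq, ← integral_conj]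
    congr 1
    ext x
    simp only [hf1, Circle.smul_def, smul_eq_mul, map_mul, inner_sub_right, ← Circle.coe_inv_eq_conj,
      ← AddChar.map_neg_eq_inv, ← mul_assoc, ← Circle.coe_mul, ← AddChar.map_add_eq_mul]
    congr 4
    ring
  have hint1 : Integrable f1 := by
    have := (Real.fourierIntegral_convergent_iff (μ := volume) (f := f) ξ).2 hf
    exact (Complex.conjCLE.toContinuousLinearMap).integrable_comp this
  have hm1 : MemLp (𝓕 f1) 2 volume := by
    have h0 : MemLp (fun η => 𝓕 f (ξ - η)) 2 volume :=
      hF.comp_measurePreserving (Measure.measurePreserving_sub_left volume ξ)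
    have h1 := h0.star
    convert h1 using 1
    ext η
    exact hF1 η
  obtain ⟨h, hh, hh'⟩ := A2 f1 hint1 hm1
  obtain ⟨k, hk, hk'⟩ := A2 g hg hG
  have := Lp.inner_fourier_eq h k
  rw [L2.inner_def, L2.inner_def] at this
  have e1 : ∫ x, inner ℂ (h x) (k x) = 𝓕 (f * g) ξ := by
    rw [Real.fourier_eq]
    apply integral_congr_ae
    filter_upwards [hh, hk] with x h1 h2
    rw [h1, h2]
    simp [hf1, Circle.smul_def]
    ring
  have e2 : ∫ x, inner ℂ ((𝓕 h : Lp (α := E3) ℂ 2 volume) x) ((𝓕 k : Lp (α := E3) ℂ 2 volume) x) = ∫ η, 𝓕 f (ξ - η) * 𝓕 g η := by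
    apply integral_congr_ae
    filter_upwards [hh', hk'] with x h1 h2
    rw [h1, h2, hF1]
    simp
    ring
  rw [← e1, ← e2, this]

theorem A5 (f g : E3 → ℂ) (hf : Integrable f) (hg : Integrable g) (hF : MemLp (𝓕 f) 2 volume)
    (hG : MemLp (𝓕 g) 2 volume) : Integrable (f * g) := by
  obtain ⟨h, hh, hh'⟩ := A2 f hf hF
  obtain ⟨k, hk, hk'⟩ := A2 g hg hG
  exact ((Lp.memLp h).ae_eq hh).integrable_mul ((Lp.memLp k).ae_eq hk)

/-- the radial kernel -/
theorem B1 : Integrable (fun x : E3 => (‖x‖ ^ 2)⁻¹ * (1 + ‖x‖ ^ 2)⁻¹) := by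
  rw [integrable_fun_norm_addHaar volume (f := fun t : ℝ => (t ^ 2)⁻¹ * (1 + t ^ 2)⁻¹)]
  refine (integrable_inv_one_add_sq.integrableOn (s := Set.Ioi 0)).congr_fun ?_ measurableSet_Ioi
  intro t ht
  have : t ≠ 0 := ne_of_gt ht
  simp
  field_simp

theorem B2 : ∃ C : ℝ, 0 ≤ C ∧ ∀ r : ℝ, 0 < r →
    ∫⁻ x : E3, ENNReal.ofReal ((‖x‖ ^ 2)⁻¹ * (r ^ 2 + ‖x‖ ^ 2)⁻¹) ≤ ENNReal.ofReal (C / r) := by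
  refine ⟨∫ x : E3, (‖x‖ ^ 2)⁻¹ * (1 + ‖x‖ ^ 2)⁻¹, integral_nonneg fun x => by positivity, ?_⟩
  intro r hr
  have e : ∀ x : E3, (‖x‖ ^ 2)⁻¹ * (r ^ 2 + ‖x‖ ^ 2)⁻¹ =
      r⁻¹ ^ 4 * ((‖r⁻¹ • x‖ ^ 2)⁻¹ * (1 + ‖r⁻¹ • x‖ ^ 2)⁻¹) := by
    intro x
    rw [norm_smul, Real.norm_of_nonneg (by positivity)]
    rcases eq_or_ne x 0 with rfl | hx
    · simp
    · have : ‖x‖ ≠ 0 := by simpa using hx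
      field_simp
  have hi := (B1.comp_smul (R := r⁻¹) (by positivity)).const_mul (r⁻¹ ^ 4)
  simp_rw [e]
  rw [← ofReal_integral_eq_lintegral_ofReal hi (Filter.Eventually.of_forall fun x => by positivity),
    integral_const_mul, Measure.integral_comp_smul volume (fun x : E3 => (‖x‖ ^ 2)⁻¹ * (1 + ‖x‖ ^ 2)⁻¹)]
  apply ENNReal.ofReal_le_ofReal
  rw [abs_of_nonneg (by positivity)]
  simp only [finrank_euclideanSpace, Fintype.card_fin, smul_eq_mul]
  apply le_of_eq
  field_simp

theorem B3 : ∃ C : ℝ, 0 ≤ C ∧ ∀ ξ : E3, ξ ≠ 0 →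
    ∫⁻ η : E3, ENNReal.ofReal ((‖ξ - η‖ ^ 2)⁻¹ * (‖η‖ ^ 2)⁻¹) ≤ ENNReal.ofReal (C / ‖ξ‖) := by
  obtain ⟨C, hC, h⟩ := B2
  refine ⟨16 * C, by positivity, fun ξ hξ => ?_⟩
  have hr : 0 < ‖ξ‖ := norm_pos_iff.2 hξ
  have hb := h ‖ξ‖ hr
  set φ : E3 → ENNReal := fun x => ENNReal.ofReal ((‖x‖ ^ 2)⁻¹ * (‖ξ‖ ^ 2 + ‖x‖ ^ 2)⁻¹) with hφ
  have hφm : Measurable φ := by fun_prop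
  have key : ∀ x y : E3, ‖ξ‖ ≤ ‖x‖ + ‖y‖ → ‖x‖ ≤ ‖y‖ →
      ENNReal.ofReal ((‖x‖ ^ 2)⁻¹ * (‖y‖ ^ 2)⁻¹) ≤ 8 * φ x := by
    intro x y h1 h2
    have e8 : (8 : ENNReal) = ENNReal.ofReal 8 := by simp
    rw [hφ, e8, ← ENNReal.ofReal_mul (by norm_num)]
    apply ENNReal.ofReal_le_ofReal
    have hy : 0 < ‖y‖ := by linarith
    have : (‖y‖ ^ 2)⁻¹ ≤ 8 * (‖ξ‖ ^ 2 + ‖x‖ ^ 2)⁻¹ := by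
      rw [← div_eq_mul_inv, le_div_iff₀ (by positivity), inv_mul_le_iff₀ (by positivity)]
      nlinarith [norm_nonneg x]
    calc _ ≤ (‖x‖ ^ 2)⁻¹ * (8 * (‖ξ‖ ^ 2 + ‖x‖ ^ 2)⁻¹) := by gcongr
      _ = _ := by ring
  calc _ ≤ ∫⁻ η : E3, (8 * φ (ξ - η) + 8 * φ η) := by
        apply lintegral_mono
        intro η
        have ht : ‖ξ‖ ≤ ‖ξ - η‖ + ‖η‖ := by simpa using norm_add_le (ξ - η) η
        rcases le_total ‖ξ - η‖ ‖η‖ with hl | hl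
        · exact (key _ _ ht hl).trans le_self_add
        · refine le_trans ?_ le_add_self
          have := key η (ξ - η) (by linarith) hl
          rwa [mul_comm] at this
    _ = 16 * ∫⁻ η : E3, φ η := by
        rw [lintegral_add_right _ (by fun_prop), lintegral_const_mul _ (by fun_prop),
          lintegral_const_mul _ (by fun_prop), lintegral_sub_left_eq_self φ ξ, ← add_mul]
        norm_num
    _ ≤ 16 * ENNReal.ofReal (C / ‖ξ‖) := by gcongr
    _ = _ := by
        rw [mul_div_assoc, ENNReal.ofReal_mul (by norm_num)]
        simp

theorem CS {u v : E3 → ENNReal} (hu : Measurable u) (hv : Measurable v) :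
    (∫⁻ x, u x * v x) ^ 2 ≤ (∫⁻ x, u x ^ 2) * ∫⁻ x, v x ^ 2 := by
  have h := ENNReal.lintegral_mul_le_Lp_mul_Lq volume Real.HolderConjugate.two_two
    hu.aemeasurable hv.aemeasurable
  calc _ ≤ ((∫⁻ x, u x ^ (2:ℝ)) ^ (1 / 2 : ℝ) * (∫⁻ x, v x ^ (2:ℝ)) ^ (1 / 2 : ℝ)) ^ 2 := by
        gcongr; exact h
    _ = _ := by
        rw [mul_pow, ← ENNReal.rpow_natCast, ← ENNReal.rpow_natCast, ← ENNReal.rpow_mul,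
          ← ENNReal.rpow_mul]
        norm_num

/-- Main bound in `lintegral` form. -/
theorem M1 : ∃ C : ℝ, 0 ≤ C ∧ ∀ F G H : E3 → ℂ, Continuous F → Continuous G →
    (∀ ξ, H ξ = ∫ η, F (ξ - η) * G η) →
    ∫⁻ ξ, ENNReal.ofReal (‖ξ‖ * ‖H ξ‖ ^ 2) ≤ ENNReal.ofReal C *
      ((∫⁻ ξ, ENNReal.ofReal (‖ξ‖ ^ 2 * ‖F ξ‖ ^ 2)) * ∫⁻ ξ, ENNReal.ofReal (‖ξ‖ ^ 2 * ‖G ξ‖ ^ 2)) := by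
  obtain ⟨C, hC, hB⟩ := B3
  refine ⟨C, hC, fun F G H hF hG hH => ?_⟩
  set a : E3 → ENNReal := fun ξ => ENNReal.ofReal (‖ξ‖ ^ 2 * ‖F ξ‖ ^ 2) with ha
  set b : E3 → ENNReal := fun ξ => ENNReal.ofReal (‖ξ‖ ^ 2 * ‖G ξ‖ ^ 2) with hb
  have ham : Measurable a := by fun_prop
  have hbm : Measurable b := by fun_prop
  have pt : ∀ ξ : E3, ENNReal.ofReal (‖ξ‖ * ‖H ξ‖ ^ 2) ≤
      ENNReal.ofReal C * ∫⁻ η, a (ξ - η) * b η := by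
    intro ξ
    rcases eq_or_ne ξ 0 with rfl | hξ
    · simp
    have hr : 0 < ‖ξ‖ := norm_pos_iff.2 hξ
    set u : E3 → ENNReal := fun η => ENNReal.ofReal (‖ξ - η‖⁻¹ * ‖η‖⁻¹) with hu
    set v : E3 → ENNReal := fun η =>
      ENNReal.ofReal ((‖ξ - η‖ * ‖F (ξ - η)‖) * (‖η‖ * ‖G η‖)) with hv
    have h1 : ‖H ξ‖ₑ ≤ ∫⁻ η, u η * v η := by
      rw [hH]
      refine (enorm_integral_le_lintegral_enorm _).trans ?_
      apply lintegral_mono_ae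
      have n0 : ∀ᵐ η : E3, η ≠ 0 := Measure.ae_ne volume 0
      have n1 : ∀ᵐ η : E3, η ≠ ξ := Measure.ae_ne volume ξ
      filter_upwards [n0, n1] with η h0 h1
      have p0 : ‖η‖ ≠ 0 := by simpa using h0
      have p1 : ‖ξ - η‖ ≠ 0 := by simpa [sub_eq_zero] using h1.symm
      rw [hu, hv, ← ENNReal.ofReal_mul (by positivity), ← ofReal_norm]
      apply ENNReal.ofReal_le_ofReal
      rw [norm_mul]
      apply le_of_eq
      field_simp
    have h2 := CS (u := u) (v := v) (by fun_prop) (by fun_prop)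
    have h3 : ∫⁻ η, u η ^ 2 ≤ ENNReal.ofReal (C / ‖ξ‖) := by
      refine le_trans (le_of_eq ?_) (hB ξ hξ)
      congr 1
      ext η
      rw [hu, ← ENNReal.ofReal_pow (by positivity)]
      congr 1
      rw [mul_pow, inv_pow, inv_pow]
    have h4 : ∫⁻ η, v η ^ 2 = ∫⁻ η, a (ξ - η) * b η := by
      congr 1
      ext η
      rw [hv, ha, hb, ← ENNReal.ofReal_pow (by positivity), ← ENNReal.ofReal_mul (by positivity)]
      congr 1
      ring
    calc _ = ENNReal.ofReal ‖ξ‖ * ‖H ξ‖ₑ ^ 2 := by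
          rw [ENNReal.ofReal_mul (by positivity), ENNReal.ofReal_pow (by positivity),
            ofReal_norm (H ξ)]
      _ ≤ ENNReal.ofReal ‖ξ‖ * (∫⁻ η, u η * v η) ^ 2 := by gcongr
      _ ≤ ENNReal.ofReal ‖ξ‖ * (ENNReal.ofReal (C / ‖ξ‖) * ∫⁻ η, a (ξ - η) * b η) := by
          gcongr
          refine h2.trans ?_
          rw [h4]
          gcongr
      _ = _ := by
          rw [← mul_assoc, ← ENNReal.ofReal_mul (by positivity)]
          congr 2
          field_simp
  calc _ ≤ ∫⁻ ξ, ENNReal.ofReal C * ∫⁻ η, a (ξ - η) * b η := lintegral_mono pt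
    _ = ENNReal.ofReal C * ∫⁻ ξ, ∫⁻ η, a (ξ - η) * b η :=
        lintegral_const_mul' _ _ ENNReal.ofReal_ne_top
    _ = ENNReal.ofReal C * ∫⁻ η, ∫⁻ ξ, a (ξ - η) * b η := by
        rw [lintegral_lintegral_swap]
        exact Measurable.aemeasurable (by fun_prop)
    _ = _ := by
        congr 1
        have : ∀ η, ∫⁻ ξ, a (ξ - η) * b η = (∫⁻ ξ, a ξ) * b η := by
          intro η
          rw [lintegral_mul_const _ (by fun_prop), lintegral_sub_right_eq_self a η]
        simp_rw [this]
        rw [lintegral_const_mul _ hbm]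

/-- Product estimate `‖fg‖_{Ḣ^{1/2}(ℝ³)} ≤ c ‖f‖_{Ḣ¹(ℝ³)} ‖g‖_{Ḣ¹(ℝ³)}`, with the
homogeneous Sobolev norms expressed via the Fourier transform. -/
theorem Hhalf_product_estimate :
    ∃ c : ℝ, 0 < c ∧
      ∀ f g : EuclideanSpace ℝ (Fin 3) → ℂ,
        Integrable f → Integrable g →
        Integrable (fun ξ : EuclideanSpace ℝ (Fin 3) => ‖ξ‖ ^ 2 * ‖𝓕 f ξ‖ ^ 2) →
        Integrable (fun ξ : EuclideanSpace ℝ (Fin 3) => ‖ξ‖ ^ 2 * ‖𝓕 g ξ‖ ^ 2) →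
        Integrable (fun ξ : EuclideanSpace ℝ (Fin 3) => ‖ξ‖ * ‖𝓕 (f * g) ξ‖ ^ 2) ∧
        Real.sqrt (∫ ξ : EuclideanSpace ℝ (Fin 3), ‖ξ‖ * ‖𝓕 (f * g) ξ‖ ^ 2)
          ≤ c * Real.sqrt (∫ ξ : EuclideanSpace ℝ (Fin 3), ‖ξ‖ ^ 2 * ‖𝓕 f ξ‖ ^ 2) *
              Real.sqrt (∫ ξ : EuclideanSpace ℝ (Fin 3), ‖ξ‖ ^ 2 * ‖𝓕 g ξ‖ ^ 2) := by
  obtain ⟨C, hC, hM⟩ := M1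
  refine ⟨Real.sqrt (C + 1), by positivity, fun f g hf hg hf1 hg1 => ?_⟩
  have hF := A3 f hf hf1
  have hG := A3 g hg hg1
  have hb := hM (𝓕 f) (𝓕 g) (𝓕 (f * g)) (A1 f hf) (A1 g hg) (A4 f g hf hg hF hG)
  rw [← ofReal_integral_eq_lintegral_ofReal hf1 (Filter.Eventually.of_forall fun x => by positivity),
    ← ofReal_integral_eq_lintegral_ofReal hg1 (Filter.Eventually.of_forall fun x => by positivity),
    ← ENNReal.ofReal_mul (integral_nonneg fun x => by positivity), ← ENNReal.ofReal_mul hC] at hb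
  have hc := A1 _ (A5 f g hf hg hF hG)
  have hm : Continuous (fun ξ : E3 => ‖ξ‖ * ‖𝓕 (f * g) ξ‖ ^ 2) := by fun_prop
  have hi : Integrable (fun ξ : E3 => ‖ξ‖ * ‖𝓕 (f * g) ξ‖ ^ 2) :=
    (lintegral_ofReal_ne_top_iff_integrable hm.aestronglyMeasurable
      (Filter.Eventually.of_forall fun x => by positivity)).1 (ne_top_of_le_ne_top ENNReal.ofReal_ne_top hb)
  refine ⟨hi, ?_⟩
  have p1 : 0 ≤ ∫ ξ : E3, ‖ξ‖ ^ 2 * ‖𝓕 f ξ‖ ^ 2 := integral_nonneg fun x => by positivity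
  have p2 : 0 ≤ ∫ ξ : E3, ‖ξ‖ ^ 2 * ‖𝓕 g ξ‖ ^ 2 := integral_nonneg fun x => by positivity
  rw [← ofReal_integral_eq_lintegral_ofReal hi (Filter.Eventually.of_forall fun x => by positivity),
    ENNReal.ofReal_le_ofReal_iff (by positivity)] at hb
  rw [mul_assoc, ← Real.sqrt_mul p1, ← Real.sqrt_mul (by positivity)]
  apply Real.sqrt_le_sqrt
  refine hb.trans ?_
  gcongr
  linarith
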